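/- Let ℓ ≥ 1 be an integer and let η be a complex number with η^s ≠ 1 for s = 1,…,ℓ. Then for all pairwise distinct complex numbers t_1,…,t_ℓ one has ∑_{k=0}^{ℓ} ( ∏_{s=0}^{k−1} (η^ℓ − η^s)/(1 − η^{s+1}) ) · ∑_{σ ∈ S_ℓ} ( ∏_{1≤a≤k} (t_{σ(a)} − 1) · ∏_{k<b≤ℓ} (t_{σ(b)} − η^{ℓ−1}) · ∏_{1≤a<b≤ℓ} (t_{σ(a)} − η t_{σ(b)})/(t_{σ(a)} − t_{σ(b)}) ) = 0 (Jing's identity). -/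

import Mathlib

open Finset
theorem pf_aux (η : ℂ) (J : Finset ℂ) : ∀ z, z ∉ J →
    ∏ y ∈ J, (z - η * y) / (z - y) = 1 + ∑ y ∈ J, (1 - η) * y / (z - y) *
      ∏ w ∈ J.erase y, (y - η * w) / (y - w) := by
  induction J using Finset.induction_on with
  | empty => simp
  | insert w J hw ih =>
    intro z hz
    rw [Finset.mem_insert, not_or] at hz
    obtain ⟨hzw, hzJ⟩ := hz
    have hzw' : z - w ≠ 0 := sub_ne_zero.mpr hzw
    rw [Finset.prod_insert hw, Finset.sum_insert hw, Finset.erase_insert hw, ih w hw, ih z hzJ]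
    have h1 : ∑ y ∈ J, (1 - η) * y / (z - y) *
        ∏ v ∈ (insert w J).erase y, (y - η * v) / (y - v) =
        ∑ y ∈ J, ((1 - η) * y / (z - y) * ∏ v ∈ J.erase y, (y - η * v) / (y - v) +
         (1 - η) * w / (z - w) * ((1 - η) * y / (z - y) * ∏ v ∈ J.erase y, (y - η * v) / (y - v)
          - (1 - η) * y / (w - y) * ∏ v ∈ J.erase y, (y - η * v) / (y - v))) := by
      refine Finset.sum_congr rfl fun y hy => ?_
      have hyw : y ≠ w := fun h => hw (h ▸ hy)
      have hyz : z ≠ y := fun h => hzJ (h ▸ hy)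
      rw [Finset.erase_insert_of_ne hyw.symm, Finset.prod_insert (by simp [hw])]
      have e1 : y - w ≠ 0 := sub_ne_zero.mpr hyw
      have e2 : z - y ≠ 0 := sub_ne_zero.mpr hyz
      have e3 : w - y ≠ 0 := sub_ne_zero.mpr hyw.symm
      generalize ∏ v ∈ J.erase y, (y - η * v) / (y - v) = X
      have : (y - η * w) / (y - w) = 1 - (1 - η) * w / (w - y) := by
        field_simp
        ring
      rw [this]
      field_simp
      ring
    rw [h1, Finset.sum_add_distrib, ← Finset.mul_sum, Finset.sum_sub_distrib]
    have : (z - η * w) / (z - w) = 1 + (1 - η) * w / (z - w) := by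
      field_simp
      ring
    rw [this]
    ring

theorem L_aux (η : ℂ) (J : Finset ℂ) :
    ∑ x ∈ J, ∏ y ∈ J.erase x, (x - η * y) / (x - y) = ∑ s ∈ range J.card, η ^ s := by
  induction J using Finset.induction_on with
  | empty => simp
  | insert w J hw ih =>
    rw [Finset.sum_insert hw, Finset.erase_insert hw, Finset.card_insert_of_notMem hw,
      Finset.sum_range_succ', pf_aux η J w hw]
    simp only [pow_succ, ← Finset.sum_mul]
    rw [← ih, Finset.sum_mul, add_comm _ (η ^ 0), pow_zero, add_assoc,
      ← Finset.sum_add_distrib]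
    congr 1
    refine Finset.sum_congr rfl fun y hy => ?_
    have hyw : y ≠ w := fun h => hw (h ▸ hy)
    rw [Finset.erase_insert_of_ne hyw.symm, Finset.prod_insert (by simp [hw])]
    have e1 : y - w ≠ 0 := sub_ne_zero.mpr hyw
    have e3 : w - y ≠ 0 := sub_ne_zero.mpr hyw.symm
    field_simp
    ring

theorem L_idx {ι : Type*} [DecidableEq ι] (η : ℂ) (t : ι → ℂ) (ht : Function.Injective t)
    (J : Finset ι) :
    ∑ x ∈ J, ∏ y ∈ J.erase x, (t x - η * t y) / (t x - t y) = ∑ s ∈ range J.card, η ^ s := by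
  rw [← Finset.card_image_of_injective J ht, ← L_aux, Finset.sum_image ht.injOn]
  refine Finset.sum_congr rfl fun x _ => ?_
  rw [← Finset.image_erase ht, Finset.prod_image ht.injOn]

noncomputable def QQ {ι : Type*} [DecidableEq ι] (a b : ι → ℂ) (φ : ι → ι → ℂ) (k : ℕ)
    (S : Finset ι) : ℂ :=
  ∑ I ∈ S.powersetCard k, (∏ i ∈ I, a i) * (∏ j ∈ S \ I, b j) * ∏ i ∈ I, ∏ j ∈ S \ I, φ i j

theorem QQ_succ {ι : Type*} [DecidableEq ι] (η : ℂ) (a b : ι → ℂ) (φ : ι → ι → ℂ)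
    (hL : ∀ J : Finset ι, ∑ x ∈ J, ∏ y ∈ J.erase x, φ x y = ∑ s ∈ range J.card, η ^ s)
    (k : ℕ) (S : Finset ι) :
    ∑ x ∈ S, a x * (∏ y ∈ S.erase x, φ x y) * QQ a b φ k (S.erase x) =
      (∑ s ∈ range (k + 1), η ^ s) * QQ a b φ (k + 1) S := by
  have h2 : (∑ s ∈ range (k + 1), η ^ s) * QQ a b φ (k + 1) S =
      ∑ I ∈ S.powersetCard (k + 1), ∑ x ∈ I, (∏ y ∈ I.erase x, φ x y) *
        ((∏ i ∈ I, a i) * (∏ j ∈ S \ I, b j) * ∏ i ∈ I, ∏ j ∈ S \ I, φ i j) := by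
    unfold QQ
    rw [Finset.mul_sum]
    refine Finset.sum_congr rfl fun I hI => ?_
    rw [← Finset.sum_mul, hL, (Finset.mem_powersetCard.mp hI).2]
  rw [h2]
  unfold QQ
  simp only [Finset.mul_sum]
  rw [Finset.sum_sigma', Finset.sum_sigma']
  refine Finset.sum_bij' (fun p _ => ⟨insert p.1 p.2, p.1⟩) (fun p _ => ⟨p.2, p.1.erase p.2⟩)
    ?_ ?_ ?_ ?_ ?_
  · rintro ⟨x, I⟩ h
    simp only [Finset.mem_sigma, Finset.mem_powersetCard] at h ⊢
    obtain ⟨hx, hI, hc⟩ := h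
    have hxI : x ∉ I := fun h => by simpa using hI h
    refine ⟨⟨?_, ?_⟩, by simp⟩
    · intro y hy
      rcases Finset.mem_insert.mp hy with rfl | hy
      · exact hx
      · exact Finset.mem_of_mem_erase (hI hy)
    · rw [Finset.card_insert_of_notMem hxI, hc]
  · rintro ⟨I, x⟩ h
    simp only [Finset.mem_sigma, Finset.mem_powersetCard] at h ⊢
    obtain ⟨⟨hI, hc⟩, hx⟩ := h
    refine ⟨hI hx, Finset.erase_subset_erase _ hI, ?_⟩
    rw [Finset.card_erase_of_mem hx, hc]
    rfl
  · rintro ⟨x, I⟩ h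
    simp only [Finset.mem_sigma, Finset.mem_powersetCard] at h ⊢
    obtain ⟨hx, hI, hc⟩ := h
    have hxI : x ∉ I := fun h => by simpa using hI h
    simp [Finset.erase_insert hxI]
  · rintro ⟨I, x⟩ h
    simp only [Finset.mem_sigma, Finset.mem_powersetCard] at h ⊢
    obtain ⟨⟨hI, hc⟩, hx⟩ := h
    simp [Finset.insert_erase hx]
  · rintro ⟨x, I⟩ h
    simp only [Finset.mem_sigma, Finset.mem_powersetCard] at h ⊢
    obtain ⟨hx, hI, hc⟩ := h
    have hxI : x ∉ I := fun h => by simpa using hI h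
    have hS : S \ insert x I = S.erase x \ I := by
      ext y; simp only [Finset.mem_sdiff, Finset.mem_insert, Finset.mem_erase]; tauto
    rw [hS, Finset.prod_insert hxI, Finset.prod_insert hxI, Finset.erase_insert hxI,
      ← Finset.prod_sdiff hI]
    ring

theorem QQ_zero {ι : Type*} [DecidableEq ι] (η : ℂ) (a b : ι → ℂ) (φ : ι → ι → ℂ)
    (hL : ∀ J : Finset ι, ∑ x ∈ J, ∏ y ∈ J.erase x, φ x y = ∑ s ∈ range J.card, η ^ s)
    (S : Finset ι) :
    ∑ x ∈ S, b x * (∏ y ∈ S.erase x, φ x y) * QQ a b φ 0 (S.erase x) =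
      (∑ s ∈ range S.card, η ^ s) * QQ a b φ 0 S := by
  rw [← hL, Finset.sum_mul]
  refine Finset.sum_congr rfl fun x hx => ?_
  simp only [QQ, Finset.powersetCard_zero, Finset.sum_singleton, Finset.prod_empty,
    Finset.sdiff_empty]
  rw [← Finset.mul_prod_erase S b hx]
  ring

noncomputable def PP {ι : Type*} (a b : ι → ℂ) (φ : ι → ι → ℂ) (n k : ℕ) (u : Fin n → ι) : ℂ :=
  ∑ σ : Equiv.Perm (Fin n), (∏ i : Fin n, if (i : ℕ) < k then a (u (σ i)) else b (u (σ i))) *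
    ∏ i : Fin n, ∏ j : Fin n, if i < j then φ (u (σ i)) (u (σ j)) else 1

noncomputable def qfac (η : ℂ) (n : ℕ) : ℂ := ∏ m ∈ range n, ∑ s ∈ range (m + 1), η ^ s

theorem PP_succ {ι : Type*} (a b : ι → ℂ) (φ : ι → ι → ℂ) (n k : ℕ)
    (u : Fin (n + 1) → ι) :
    PP a b φ (n + 1) k u = ∑ p : Fin (n + 1), (if 0 < k then a (u p) else b (u p)) *
      (∏ j : Fin n, φ (u p) (u (Equiv.swap 0 p j.succ))) *
      PP a b φ n (k - 1) (fun j => u (Equiv.swap 0 p j.succ)) := by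
  unfold PP
  rw [← Equiv.sum_comp Equiv.Perm.decomposeFin.symm, Fintype.sum_prod_type]
  refine Finset.sum_congr rfl fun p _ => ?_
  rw [Finset.mul_sum]
  refine Finset.sum_congr rfl fun e _ => ?_
  rw [← Equiv.prod_comp e (fun j => φ (u p) (u (Equiv.swap 0 p j.succ)))]
  have hk : ∀ m : ℕ, m + 1 < k ↔ m < k - 1 := fun m => by omega
  simp only [Fin.prod_univ_succ, Equiv.Perm.decomposeFin_symm_apply_succ,
    Equiv.Perm.decomposeFin_symm_apply_zero, Fin.succ_lt_succ_iff, Fin.val_zero, Fin.val_succ,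
    Fin.succ_pos, if_true, if_false, Fin.not_lt_zero, one_mul, hk]
  ring

theorem image_aux {ι : Type*} [DecidableEq ι] (n : ℕ) (u : Fin (n + 1) → ι)
    (hu : Function.Injective u) (p : Fin (n + 1)) :
    univ.image (fun j : Fin n => u (Equiv.swap 0 p j.succ)) = (univ.image u).erase (u p) := by
  ext y
  simp only [Finset.mem_image, Finset.mem_univ, true_and, Finset.mem_erase]
  constructor
  · rintro ⟨j, rfl⟩
    refine ⟨fun h => ?_, _, rfl⟩
    have h1 := hu h
    rw [Equiv.swap_apply_eq_iff, Equiv.swap_apply_right] at h1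
    exact Fin.succ_ne_zero _ h1
  · rintro ⟨h, q, rfl⟩
    have hq : Equiv.swap 0 p q ≠ 0 := by
      intro h1
      rw [Equiv.swap_apply_eq_iff, Equiv.swap_apply_left] at h1
      exact h (by rw [h1])
    obtain ⟨j, hj⟩ := Fin.exists_succ_eq.mpr hq
    exact ⟨j, by rw [hj, Equiv.swap_apply_self]⟩

theorem PP_eq {ι : Type*} [DecidableEq ι] (η : ℂ) (a b : ι → ℂ) (φ : ι → ι → ℂ)
    (hL : ∀ J : Finset ι, ∑ x ∈ J, ∏ y ∈ J.erase x, φ x y = ∑ s ∈ range J.card, η ^ s)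
    (n : ℕ) : ∀ (k : ℕ) (_ : k ≤ n) (u : Fin n → ι) (_ : Function.Injective u),
    PP a b φ n k u = qfac η k * qfac η (n - k) * QQ a b φ k (univ.image u) := by
  induction n with
  | zero =>
    intro k hk u hu
    obtain rfl : k = 0 := by omega
    simp [PP, QQ, qfac]
  | succ n ih =>
    intro k hk u hu
    have hinj : ∀ p, Function.Injective (fun j : Fin n => u (Equiv.swap 0 p j.succ)) :=
      fun p => hu.comp ((Equiv.injective _).comp (Fin.succ_injective n))
    have hprod : ∀ p, ∏ j : Fin n, φ (u p) (u (Equiv.swap 0 p j.succ)) =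
        ∏ y ∈ (univ.image u).erase (u p), φ (u p) y := by
      intro p
      rw [← image_aux n u hu p, Finset.prod_image (hinj p).injOn]
    rw [PP_succ]
    rcases k with _ | k
    · have hQ := QQ_zero η a b φ hL (univ.image u)
      rw [Finset.sum_image hu.injOn, Finset.card_image_of_injective _ hu, Finset.card_univ,
        Fintype.card_fin] at hQ
      have : qfac η (n + 1 - 0) = qfac η n * ∑ s ∈ range (n + 1), η ^ s := by
        simp [qfac, Finset.prod_range_succ]
      rw [this, mul_assoc, mul_assoc, ← hQ, Finset.mul_sum, Finset.mul_sum]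
      refine Finset.sum_congr rfl fun p _ => ?_
      rw [ih (0 - 1) (by omega) _ (hinj p), hprod, image_aux n u hu p]
      simp
      ring
    · have hQ := QQ_succ η a b φ hL k (univ.image u)
      rw [Finset.sum_image hu.injOn] at hQ
      have : qfac η (k + 1) = qfac η k * ∑ s ∈ range (k + 1), η ^ s := by
        simp [qfac, Finset.prod_range_succ]
      have hr : ∀ A S f Q : ℂ, A * S * f * Q = A * f * (S * Q) := fun _ _ _ _ => by ring
      rw [this, hr, ← hQ, Finset.mul_sum]
      refine Finset.sum_congr rfl fun p _ => ?_
      rw [ih (k + 1 - 1) (by omega) _ (hinj p), hprod, image_aux n u hu p]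
      simp
      ring

theorem coef_aux (ℓ : ℕ) (η : ℂ) (hη : ∀ s : ℕ, 1 ≤ s → s ≤ ℓ → η ^ s ≠ 1) (k : ℕ) :
    k ≤ ℓ → (∏ s ∈ Finset.range k, (η ^ ℓ - η ^ s) / (1 - η ^ (s + 1))) *
      (qfac η k * qfac η (ℓ - k)) = qfac η ℓ * ((-1) ^ k * η ^ (k.choose 2)) := by
  induction k with
  | zero => simp [qfac]
  | succ k ih =>
    intro hk
    have ih := ih (by omega)
    obtain ⟨m, rfl⟩ : ∃ m, ℓ = k + 1 + m := ⟨ℓ - (k + 1), by omega⟩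
    have e1 : k + 1 + m - k = m + 1 := by omega
    have e2 : k + 1 + m - (k + 1) = m := by omega
    have hs : ∀ n, qfac η (n + 1) = qfac η n * ∑ s ∈ range (n + 1), η ^ s := by
      intro n; simp [qfac, Finset.prod_range_succ]
    rw [e1, hs] at ih
    have hne : 1 - η ^ (k + 1) ≠ 0 := sub_ne_zero.mpr (hη (k + 1) (by omega) (by omega)).symm
    have g1 := mul_neg_geom_sum η (k + 1)
    have g2 := mul_neg_geom_sum η (m + 1)
    have key : (η ^ (k + 1 + m) - η ^ k) / (1 - η ^ (k + 1)) * ∑ s ∈ range (k + 1), η ^ s =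
        - η ^ k * ∑ s ∈ range (m + 1), η ^ s := by
      rw [div_mul_eq_mul_div, div_eq_iff hne, ← g1]
      have : η ^ (k + 1 + m) - η ^ k = - η ^ k * (1 - η ^ (m + 1)) := by ring
      rw [this, ← g2]
      ring
    have hc : (k + 1).choose 2 = k + k.choose 2 := by
      rw [Nat.choose_succ_succ' k 1, Nat.choose_one_right]
    rw [e2, hs, Finset.prod_range_succ, hc, pow_add η k, pow_succ (-1 : ℂ)]
    generalize (∏ s ∈ Finset.range k, (η ^ (k + 1 + m) - η ^ s) / (1 - η ^ (s + 1))) = X at *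
    linear_combination (-η ^ k) * ih + X * qfac η k * qfac η m * key

theorem det_zero_aux (n : ℕ) (hn : 1 ≤ n) (η : ℂ) (x : Fin n → ℂ) :
    Matrix.det (Matrix.of fun j i : Fin n => -(x j - 1) * (x j ^ (i : ℕ) * η ^ (i.rev : ℕ)) +
      (x j - η ^ (n - 1)) * (x j ^ (i : ℕ) * 1 ^ (i.rev : ℕ))) = 0 := by
  set C : Matrix (Fin n) (Fin n) ℂ := Matrix.of fun m i =>
    (if (m : ℕ) = i + 1 then 1 - η ^ (i.rev : ℕ) else 0) -
      (if m = i then η ^ (n - 1) - η ^ (i.rev : ℕ) else 0) with hC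
  have hfac : (Matrix.of fun j i : Fin n => -(x j - 1) * (x j ^ (i : ℕ) * η ^ (i.rev : ℕ)) +
      (x j - η ^ (n - 1)) * (x j ^ (i : ℕ) * 1 ^ (i.rev : ℕ))) = Matrix.vandermonde x * C := by
    ext j i
    simp only [Matrix.mul_apply, Matrix.vandermonde_apply, hC, Matrix.of_apply, mul_sub,
      Finset.sum_sub_distrib, mul_ite, mul_zero, Finset.sum_ite_eq', Finset.mem_univ, if_true]
    have h : ∑ m : Fin n, (if (m : ℕ) = i + 1 then x j ^ (m : ℕ) * 1 - x j ^ (m : ℕ) * η ^ (i.rev : ℕ) else 0) =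
        x j ^ ((i : ℕ) + 1) * (1 - η ^ (i.rev : ℕ)) := by
      by_cases hi : (i : ℕ) + 1 < n
      · rw [Finset.sum_eq_single (⟨i + 1, hi⟩ : Fin n)]
        · simp; ring
        · intro m _ hm
          rw [if_neg]
          intro h; exact hm (Fin.ext h)
        · simp
      · have h0 : (i.rev : ℕ) = 0 := by rw [Fin.val_rev]; omega
        rw [h0, pow_zero, sub_self, mul_zero]
        refine Finset.sum_eq_zero fun m _ => ?_
        rw [if_neg]
        have := m.2
        omega
    rw [h]
    simp only [one_pow]
    ring
  have hC0 : C.det = 0 := by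
    refine Matrix.det_eq_zero_of_row_eq_zero (⟨0, hn⟩ : Fin n) fun i => ?_
    simp only [hC, Matrix.of_apply]
    rw [if_neg (by simp)]
    by_cases h : (⟨0, hn⟩ : Fin n) = i
    · subst h
      simp [Fin.val_rev]
    · simp [h]
  rw [hfac, Matrix.det_mul, hC0, mul_zero]

theorem det_expand (n : ℕ) (hn : 1 ≤ n) (η : ℂ) (x : Fin n → ℂ) :
    ∑ s : Finset (Fin n), (∏ j, if j ∈ s then -(x j - 1) else (x j - η ^ (n - 1))) *
      ∏ i : Fin n, ∏ j ∈ Finset.Ioi i,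
        (x j * (if i ∈ s then η else 1) - x i * (if j ∈ s then η else 1)) = 0 := by
  have h := det_zero_aux n hn η x
  have h2 := (Matrix.detRowAlternating (n := Fin n) (R := ℂ)).map_add_univ
    (fun j i => -(x j - 1) * (x j ^ (i : ℕ) * η ^ (i.rev : ℕ)))
    (fun j i => (x j - η ^ (n - 1)) * (x j ^ (i : ℕ) * 1 ^ (i.rev : ℕ)))
  have h3 : Matrix.detRowAlternating ((fun j i : Fin n => -(x j - 1) * (x j ^ (i : ℕ) * η ^ (i.rev : ℕ)))
    + (fun j i : Fin n => (x j - η ^ (n - 1)) * (x j ^ (i : ℕ) * 1 ^ (i.rev : ℕ)))) = 0 := h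
  rw [h3] at h2
  rw [h2]
  refine Finset.sum_congr rfl fun s _ => ?_
  have := Matrix.det_projVandermonde x (fun i => if i ∈ s then η else 1)
  rw [← this, ← Matrix.det_mul_column]
  change _ = Matrix.det _
  congr 1
  ext j i
  simp only [Matrix.of_apply, Matrix.projVandermonde_apply]
  by_cases hj : j ∈ s <;> simp [hj, Finset.piecewise]

theorem card_pairs (n : ℕ) (s : Finset (Fin n)) :
    (univ.filter fun p : Fin n × Fin n => p.1 < p.2 ∧ p.1 ∈ s ∧ p.2 ∈ s).card =
      s.card.choose 2 := by
  have h1 : (univ.filter fun p : Fin n × Fin n => p.1 < p.2 ∧ p.1 ∈ s ∧ p.2 ∈ s).card =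
      (univ.filter fun p : Fin n × Fin n => p.2 < p.1 ∧ p.1 ∈ s ∧ p.2 ∈ s).card := by
    refine Finset.card_bij' (fun p _ => p.swap) (fun p _ => p.swap) ?_ ?_ ?_ ?_ <;>
      simp +contextual
  have h2 : s.offDiag = (univ.filter fun p : Fin n × Fin n => p.1 < p.2 ∧ p.1 ∈ s ∧ p.2 ∈ s) ∪
      (univ.filter fun p : Fin n × Fin n => p.2 < p.1 ∧ p.1 ∈ s ∧ p.2 ∈ s) := by
    ext p
    simp only [Finset.mem_offDiag, Finset.mem_union, Finset.mem_filter, Finset.mem_univ, true_and]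
    rw [ne_iff_lt_or_gt]
    tauto
  have h3 := s.offDiag_card
  rw [h2, Finset.card_union_of_disjoint, ← h1] at h3
  · rw [Nat.choose_two_right, Nat.mul_sub_one, ← h3]
    omega
  · rw [Finset.disjoint_left]
    intro p
    simp only [Finset.mem_filter, Finset.mem_univ, true_and]
    intro h h'
    exact absurd h.1 (not_lt.mpr h'.1.le)

theorem pair_prod (n : ℕ) (η : ℂ) (x : Fin n → ℂ) (hx : Function.Injective x)
    (s : Finset (Fin n)) :
    ∏ i : Fin n, ∏ j ∈ Finset.Ioi i,
        (x j * (if i ∈ s then η else 1) - x i * (if j ∈ s then η else 1)) =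
    (η ^ (s.card.choose 2) * ∏ i ∈ s, ∏ j ∈ univ \ s, (x i - η * x j) / (x i - x j)) *
      ∏ i : Fin n, ∏ j ∈ Finset.Ioi i, (x j - x i) := by
  set φ : Fin n → Fin n → ℂ := fun i j => (x i - η * x j) / (x i - x j) with hφ
  have hI : ∀ (f : Fin n → Fin n → ℂ), ∏ i : Fin n, ∏ j ∈ Finset.Ioi i, f i j =
      ∏ i : Fin n, ∏ j : Fin n, if i < j then f i j else 1 := by
    intro f
    refine Finset.prod_congr rfl fun i _ => ?_
    rw [← Finset.prod_filter]
    congr 1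
    ext j; simp
  have h1 : ∏ i : Fin n, ∏ j ∈ Finset.Ioi i,
        (x j * (if i ∈ s then η else 1) - x i * (if j ∈ s then η else 1)) =
      ∏ i : Fin n, ∏ j ∈ Finset.Ioi i, ((if i ∈ s ∧ j ∈ s then η else 1) *
        ((if i ∈ s ∧ j ∉ s then φ i j else 1) * (if j ∈ s ∧ i ∉ s then φ j i else 1)) *
        (x j - x i)) := by
    refine Finset.prod_congr rfl fun i _ => Finset.prod_congr rfl fun j hj => ?_
    have hij : i ≠ j := (Finset.mem_Ioi.mp hj).ne
    have e1 : x i - x j ≠ 0 := sub_ne_zero.mpr (hx.ne hij)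
    have e2 : x j - x i ≠ 0 := sub_ne_zero.mpr (hx.ne hij.symm)
    by_cases hi : i ∈ s <;> by_cases hj : j ∈ s <;> simp [hi, hj, hφ] <;> field_simp <;> ring
  rw [h1]
  simp only [Finset.prod_mul_distrib]
  congr 1
  congr 1
  · rw [hI, ← card_pairs, ← Finset.prod_const, Finset.prod_filter, ← Finset.univ_product_univ,
      Finset.prod_product]
    refine Finset.prod_congr rfl fun i _ => Finset.prod_congr rfl fun j _ => ?_
    simp only [ite_and]
  · rw [hI, hI]
    have hsw : (∏ i : Fin n, ∏ j : Fin n, if i < j then (if j ∈ s ∧ i ∉ s then φ j i else 1) else 1) =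
      ∏ i : Fin n, ∏ j : Fin n, if j < i then (if i ∈ s ∧ j ∉ s then φ i j else 1) else 1 :=
      Finset.prod_comm
    rw [hsw]
    simp only [← Finset.prod_mul_distrib]
    have hs : ∏ i ∈ s, ∏ j ∈ univ \ s, φ i j = ∏ i, ∏ j, if i ∈ s ∧ j ∉ s then φ i j else 1 := by
      rw [← Finset.prod_subset (Finset.subset_univ s)]
      · refine Finset.prod_congr rfl fun i hi => ?_
        simp only [hi, true_and]
        rw [← Finset.prod_filter]
        congr 1
        ext j; simp
      · intro i _ hi
        simp [hi]
    rw [hs]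
    refine Finset.prod_congr rfl fun i _ => Finset.prod_congr rfl fun j _ => ?_
    rcases lt_trichotomy i j with h | h | h
    · simp [h, h.not_gt]
    · subst h; simp
    · simp [h, h.not_gt]

theorem subset_identity (n : ℕ) (hn : 1 ≤ n) (η : ℂ) (x : Fin n → ℂ)
    (hx : Function.Injective x) :
    ∑ k ∈ range (n + 1), ((-1) ^ k * η ^ (k.choose 2)) *
      QQ (fun i => x i - 1) (fun i => x i - η ^ (n - 1))
        (fun i j => (x i - η * x j) / (x i - x j)) k univ = 0 := by
  have h := det_expand n hn η x
  have hV : ∏ i : Fin n, ∏ j ∈ Finset.Ioi i, (x j - x i) ≠ 0 := by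
    refine Finset.prod_ne_zero_iff.mpr fun i _ => Finset.prod_ne_zero_iff.mpr fun j hj => ?_
    exact sub_ne_zero.mpr (hx.ne (Finset.mem_Ioi.mp hj).ne')
  simp only [pair_prod n η x hx, ← mul_assoc] at h
  rw [← Finset.sum_mul] at h
  have h := (mul_eq_zero.mp h).resolve_right hV
  rw [← h, ← Finset.powerset_univ, Finset.sum_powerset, Finset.card_univ, Fintype.card_fin]
  refine Finset.sum_congr rfl fun k _ => ?_
  rw [QQ, Finset.mul_sum]
  refine Finset.sum_congr rfl fun s hs => ?_
  have hc := (Finset.mem_powersetCard.mp hs).2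
  have : (∏ j, if j ∈ s then -(x j - 1) else (x j - η ^ (n - 1))) =
      (-1) ^ k * (∏ i ∈ s, (x i - 1)) * ∏ j ∈ univ \ s, (x j - η ^ (n - 1)) := by
    rw [Finset.prod_ite, ← hc, ← Finset.prod_const, ← Finset.prod_mul_distrib]
    congr 1
    · refine Finset.prod_congr (by ext; simp) fun i _ => by ring
    · refine Finset.prod_congr (by ext; simp) fun i _ => rfl
  rw [this, hc]
  ring

/-- **Jing's identity.** For an integer `ℓ ≥ 1` and `η : ℂ` with `η^s ≠ 1` for `s = 1,…,ℓ`,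
and pairwise distinct `t_1,…,t_ℓ`, the alternating-type sum vanishes. -/
theorem jing_identity (ℓ : ℕ) (hℓ : 1 ≤ ℓ) (η : ℂ)
    (hη : ∀ s : ℕ, 1 ≤ s → s ≤ ℓ → η ^ s ≠ 1)
    (t : Fin ℓ → ℂ) (ht : Function.Injective t) :
    ∑ k ∈ Finset.range (ℓ + 1),
      (∏ s ∈ Finset.range k, (η ^ ℓ - η ^ s) / (1 - η ^ (s + 1))) *
        ∑ σ : Equiv.Perm (Fin ℓ),
          (∏ a ∈ Finset.univ.filter (fun a : Fin ℓ => (a : ℕ) < k), (t (σ a) - 1)) *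
            (∏ b ∈ Finset.univ.filter (fun b : Fin ℓ => k ≤ (b : ℕ)),
              (t (σ b) - η ^ (ℓ - 1))) *
            ∏ p ∈ Finset.univ.filter (fun p : Fin ℓ × Fin ℓ => p.1 < p.2),
              (t (σ p.1) - η * t (σ p.2)) / (t (σ p.1) - t (σ p.2)) = 0 := by
  have key : ∀ k ∈ Finset.range (ℓ + 1),
      (∏ s ∈ Finset.range k, (η ^ ℓ - η ^ s) / (1 - η ^ (s + 1))) *
        ∑ σ : Equiv.Perm (Fin ℓ),
          (∏ a ∈ Finset.univ.filter (fun a : Fin ℓ => (a : ℕ) < k), (t (σ a) - 1)) *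
            (∏ b ∈ Finset.univ.filter (fun b : Fin ℓ => k ≤ (b : ℕ)),
              (t (σ b) - η ^ (ℓ - 1))) *
            ∏ p ∈ Finset.univ.filter (fun p : Fin ℓ × Fin ℓ => p.1 < p.2),
              (t (σ p.1) - η * t (σ p.2)) / (t (σ p.1) - t (σ p.2)) =
      qfac η ℓ * (((-1) ^ k * η ^ (k.choose 2)) *
        QQ (fun i => t i - 1) (fun i => t i - η ^ (ℓ - 1))
          (fun i j => (t i - η * t j) / (t i - t j)) k univ) := by
    intro k hk
    have hk' : k ≤ ℓ := by simpa [Nat.lt_succ_iff] using hk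
    have hP := PP_eq η (fun i => t i - 1) (fun i => t i - η ^ (ℓ - 1))
      (fun i j => (t i - η * t j) / (t i - t j)) (L_idx η t ht) ℓ k hk' id Function.injective_id
    rw [Finset.image_id] at hP
    rw [← mul_assoc, ← coef_aux ℓ η hη k hk', mul_assoc, ← hP]
    congr 1
    unfold PP
    refine Finset.sum_congr rfl fun σ _ => ?_
    congr 1
    · rw [Finset.prod_ite]
      simp only [not_lt, id]
    · rw [Finset.prod_filter, ← Finset.univ_product_univ, Finset.prod_product]
      rfl
  rw [Finset.sum_congr rfl key, ← Finset.mul_sum, subset_identity ℓ hℓ η t ht, mul_zero]
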